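/- Let C : f = 0 be a reduced plane curve of degree d ≥ 3 in P²(ℂ), not the union of d lines through one point, and let r = mdr(f). Then τ(C) = (d−1)² − r(d−r−1) − 1 if and only if C is a nearly free curve; moreover, in that case 2r ≤ d. -/

import Mathlib

open MvPolynomial

noncomputable section

/-- `S = ℂ[x,y,z]`, with `x = X 0`, `y = X 1`, `z = X 2`. -/
abbrev S3 := MvPolynomial (Fin 3) ℂ

/-- The graded `S`-module `D_0(f)` of Jacobian syzygies of `f`. -/
def jacSyz (f : S3) : Submodule S3 (Fin 3 → S3) where
  carrier := {v | v 0 * pderiv 0 f + v 1 * pderiv 1 f + v 2 * pderiv 2 f = 0}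
  add_mem' := by
    intro a b ha hb
    simp only [Set.mem_setOf_eq, Pi.add_apply] at *
    linear_combination ha + hb
  zero_mem' := by simp
  smul_mem' := by
    intro c v hv
    simp only [Set.mem_setOf_eq, Pi.smul_apply, smul_eq_mul] at *
    linear_combination c * hv

/-- `v` is a minimal system of `m` homogeneous generators of `D_0(f)`, the generator
`v j` being a syzygy of degree `dd j`, and `dd` nondecreasing: this says that
`C : f = 0` is an `m`-syzygy curve with exponents `dd`. -/
structure IsMinGenSyz (f : S3) (m : ℕ) (dd : Fin m → ℕ) (v : Fin m → (Fin 3 → S3)) : Prop where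
  mem : ∀ j, v j ∈ jacSyz f
  hom : ∀ j i, ((v j) i).IsHomogeneous (dd j)
  ne_zero : ∀ j, v j ≠ 0
  span_eq : Submodule.span S3 (Set.range v) = jacSyz f
  minimal : ∀ j, v j ∉ Submodule.span S3 (v '' {j' | j' ≠ j})
  mono : Monotone dd

/-- `C : f = 0` is free with exponents `(d1, d2)`. -/
def IsFreeWith (f : S3) (d1 d2 : ℕ) : Prop := ∃ v, IsMinGenSyz f 2 ![d1, d2] v

/-- `C : f = 0` is a free curve (a 2-syzygy curve). -/
def IsFreeCurve (f : S3) : Prop := ∃ d1 d2, IsFreeWith f d1 d2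

/-- `C : f = 0` of degree `d` is nearly free with exponents `(d1, d2)`:
a 3-syzygy curve with exponents `(d1, d2, d2)` and `d1 + d2 = d`. -/
def IsNearlyFreeWith (f : S3) (d d1 d2 : ℕ) : Prop :=
  d1 + d2 = d ∧ ∃ v, IsMinGenSyz f 3 ![d1, d2, d2] v

/-- `C : f = 0` of degree `d` is a nearly free curve. -/
def IsNearlyFree (f : S3) (d : ℕ) : Prop := ∃ d1 d2, IsNearlyFreeWith f d d1 d2

/-- `C : f = 0` of degree `d` is plus-one generated with exponents `(d1, d2, d3)`:
a 3-syzygy curve with `d1 + d2 = d`. -/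
def IsPOGWith (f : S3) (d d1 d2 d3 : ℕ) : Prop :=
  d1 + d2 = d ∧ ∃ v, IsMinGenSyz f 3 ![d1, d2, d3] v

/-- `C : f = 0` of degree `d` is a plus-one generated curve. -/
def IsPOG (f : S3) (d : ℕ) : Prop := ∃ d1 d2 d3, IsPOGWith f d d1 d2 d3

/-- `C : f = 0` of degree `d` is minimal plus-one generated (MPOG),
with exponents `(d1, d2, d2 + 1)`. -/
def IsMPOGWith (f : S3) (d d1 d2 : ℕ) : Prop := IsPOGWith f d d1 d2 (d2 + 1)

/-- `C : f = 0` of degree `d` is an MPOG-curve. -/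
def IsMPOG (f : S3) (d : ℕ) : Prop := ∃ d1 d2, IsMPOGWith f d d1 d2

/-- `r = mdr(f)`: the minimal degree of a nonzero (homogeneous) Jacobian relation for `f`. -/
def IsMDR (f : S3) (r : ℕ) : Prop :=
  (∃ v ∈ jacSyz f, v ≠ 0 ∧ ∀ i, (v i).IsHomogeneous r) ∧
  ∀ m, m < r → ∀ v ∈ jacSyz f, (∀ i, (v i).IsHomogeneous m) → v = 0

/-- The Jacobian ideal `J_f` of `f`. -/
def jacobianIdeal (f : S3) : Ideal S3 := Ideal.span {pderiv 0 f, pderiv 1 f, pderiv 2 f}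

/-- The dimension of the degree `k` graded piece of the Milnor algebra `M(f) = S/J_f`. -/
def milnorDim (f : S3) (k : ℕ) : ℕ :=
  Module.finrank ℂ
    (↥(homogeneousSubmodule (Fin 3) ℂ k) ⧸
      (Submodule.comap (homogeneousSubmodule (Fin 3) ℂ k).subtype
        (Submodule.restrictScalars ℂ (jacobianIdeal f))))

/-- `τ` is the total Tjurina number of the reduced curve `C : f = 0`, i.e. the degree of the
Jacobian ideal `J_f`: for all large `k` one has `dim M(f)_k = τ`. -/
def IsTjurina (f : S3) (τ : ℕ) : Prop := ∀ᶠ k in Filter.atTop, milnorDim f k = τ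

/-- `C : f = 0` is a maximal Tjurina curve of type `(d, r)`. -/
def IsMaxTjurina (f : S3) (d r : ℕ) : Prop :=
  IsMDR f r ∧ d ≤ 2 * r ∧
  ∃ τ : ℕ, IsTjurina f τ ∧
    (τ : ℤ) = ((d : ℤ) - 1) ^ 2 - r * ((d : ℤ) - r - 1) - (Nat.choose (2 * r + 2 - d) 2 : ℤ)

/-- `f` is a product of `d` linear forms all vanishing at a common point, i.e.
`C : f = 0` is the union of `d` lines passing through one point. -/
def IsUnionOfConcurrentLines (f : S3) (d : ℕ) : Prop :=
  ∃ (c : ℂ) (L : Fin d → Fin 3 → ℂ) (v : Fin 3 → ℂ), v ≠ 0 ∧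
    f = C c * ∏ j, (∑ i, C (L j i) * X i) ∧ ∀ j, (∑ i, L j i * v i) = 0

/-- The ideal `I_θ` generated by the 2×2 minors of the matrix with rows `(x,y,z)` and
`(a,b,c)`, defining the eigenscheme `Γ_θ` of the derivation `θ = a ∂_x + b ∂_y + c ∂_z`. -/
def eigenIdeal (a b c : S3) : Ideal S3 :=
  Ideal.span {X 1 * c - X 2 * b, X 2 * a - X 0 * c, X 0 * b - X 1 * a}

/-- The projective plane `ℙ²(ℂ)`. -/
abbrev Pt := Projectivization ℂ (Fin 3 → ℂ)

/-- The eigenscheme `Γ_θ` of `θ = a ∂_x + b ∂_y + c ∂_z` is 0-dimensional: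
its set of points in `ℙ²` is finite. -/
def EigenSchemeFinite (a b c : S3) : Prop :=
  {p : Pt | eval p.rep (X 1 * c - X 2 * b) = 0 ∧ eval p.rep (X 2 * a - X 0 * c) = 0 ∧
      eval p.rep (X 0 * b - X 1 * a) = 0}.Finite

/-! ### Vectors over a factorial domain -/

theorem dvd_of_forall_dvd_mul {R ι : Type*} [CommRing R] [IsDomain R]
    [UniqueFactorizationMonoid R] {a : ι → R} (ha : ∀ p, Prime p → ∃ i, ¬ p ∣ a i) (x : R) :
    x ≠ 0 → ∀ y, (∀ i, x ∣ y * a i) → x ∣ y := by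
  induction x using UniqueFactorizationMonoid.induction_on_prime with
  | h₁ => exact fun h => absurd rfl h
  | h₂ x hx => exact fun _ y _ => hx.dvd
  | h₃ x p hx hp ih =>
    intro _ y hy
    obtain ⟨i, hi⟩ := ha p hp
    obtain ⟨z, rfl⟩ := (hp.dvd_or_dvd ((dvd_mul_right p x).trans (hy i))).resolve_right hi
    refine mul_dvd_mul_left p (ih hx z fun j => ?_)
    have := hy j
    rw [mul_assoc] at this
    exact (mul_dvd_mul_iff_left hp.ne_zero).1 this

open Matrix in
theorem exists_eq_smul_of_cross_eq_zero {R : Type*} [CommRing R] [IsDomain R]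
    [UniqueFactorizationMonoid R] {a : Fin 3 → R} (ha : ∀ p, Prime p → ∃ i, ¬ p ∣ a i)
    (ha0 : a ≠ 0) {u : Fin 3 → R} (h : a ⨯₃ u = 0) : ∃ s : R, u = s • a := by
  have h0 := congrFun h 0
  have h1 := congrFun h 1
  have h2 := congrFun h 2
  simp only [cross_apply, cons_val, Pi.zero_apply] at h0 h1 h2
  have key : ∀ i j, a i * u j = a j * u i := by
    intro i j
    fin_cases i <;> fin_cases j <;> simp <;>
      first
      | ring1
      | linear_combination h0
      | linear_combination h1
      | linear_combination h2
      | linear_combination -h0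
      | linear_combination -h1
      | linear_combination -h2
  obtain ⟨i, hi⟩ := Function.ne_iff.1 ha0
  obtain ⟨s, hs⟩ := dvd_of_forall_dvd_mul ha (a i) hi (u i)
    fun j => ⟨u j, by rw [mul_comm, ← key]⟩
  refine ⟨s, funext fun j => mul_left_cancel₀ hi ?_⟩
  rw [key, hs]
  simp only [Pi.smul_apply, smul_eq_mul]
  ring

/-! ### Polynomials in three variables -/

theorem homogeneousComponent_add_mul {σ R : Type*} [CommSemiring R] {a : MvPolynomial σ R} {m : ℕ}
    (ha : a.IsHomogeneous m) (n : ℕ) (b : MvPolynomial σ R) :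
    homogeneousComponent (m + n) (a * b) = a * homogeneousComponent n b := by
  conv_lhs => rw [← sum_homogeneousComponent b, Finset.mul_sum, map_sum]
  rw [Finset.sum_congr rfl fun i _ => homogeneousComponent_of_mem
    (ha.mul (homogeneousComponent_isHomogeneous i b))]
  simp only [add_right_inj]
  rw [Finset.sum_ite_eq, ite_eq_left_iff]
  intro h
  rw [homogeneousComponent_eq_zero _ _ (by simpa [Nat.lt_succ_iff] using h), mul_zero]

theorem homogeneousComponent_mul_of_lt {σ R : Type*} [CommSemiring R] {a : MvPolynomial σ R} {m : ℕ}
    (ha : a.IsHomogeneous m) {n : ℕ} (hn : n < m) (b : MvPolynomial σ R) :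
    homogeneousComponent n (a * b) = 0 := by
  rw [← sum_homogeneousComponent b, Finset.mul_sum, map_sum]
  refine Finset.sum_eq_zero fun i _ => ?_
  rw [homogeneousComponent_of_mem (ha.mul (homogeneousComponent_isHomogeneous i b)),
    if_neg (by omega)]

theorem ext_homogeneousComponent {σ R : Type*} [CommSemiring R] {a b : MvPolynomial σ R}
    (h : ∀ n, homogeneousComponent n a = homogeneousComponent n b) : a = b := by
  ext m
  have := congrArg (coeff m) (h m.degree)
  simpa [coeff_homogeneousComponent] using this

theorem exists_eq_sum_C_mul_X {σ R : Type*} [Fintype σ] [CommSemiring R] {l : MvPolynomial σ R}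
    (hl : l.IsHomogeneous 1) : ∃ a : σ → R, l = ∑ i, C (a i) * X i := by
  have : l ∈ homogeneousSubmodule σ R 1 := hl
  rw [homogeneousSubmodule_one_eq_span_X, Submodule.mem_span_range_iff_exists_fun] at this
  obtain ⟨a, ha⟩ := this
  exact ⟨a, by simpa [smul_eq_C_mul] using ha.symm⟩

theorem isUnit_of_forall_pderiv_eq_zero {p : S3} (hp : p ≠ 0) (h : ∀ i, pderiv i p = 0) :
    IsUnit p := by
  have hC : p = C (coeff 0 p) := by
    ext m
    rw [coeff_C]
    split_ifs with hm
    · rw [hm]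
    · obtain ⟨i, hi⟩ := Finsupp.ne_iff.1 (Ne.symm hm)
      have := congrArg (coeff (m - Finsupp.single i 1)) (h i)
      rw [coeff_pderiv, coeff_zero, tsub_add_cancel_of_le
        (by simpa [Nat.one_le_iff_ne_zero] using hi)] at this
      rcases mul_eq_zero.1 this with h' | h'
      · exact h'
      · norm_cast at h'
  rw [hC]
  refine (isUnit_iff_ne_zero.2 fun h0 => hp ?_).map C
  rw [hC, h0, C_0]

theorem pderiv_eq_zero_of_dvd {p : S3} {i : Fin 3} (h : p ∣ pderiv i p) : pderiv i p = 0 := by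
  by_contra h0
  obtain ⟨q, hq⟩ := h
  have hq0 : q ≠ 0 := by rintro rfl; simp_all
  have hp0 : p ≠ 0 := by rintro rfl; simp_all
  have hdeg : degreeOf i p ≤ degreeOf i (pderiv i p) := by
    conv_rhs => rw [hq, degreeOf_mul_eq hp0 hq0]
    omega
  have hpos : 0 < degreeOf i p := by
    by_contra hc
    refine h0 (pderiv_eq_zero_of_notMem_vars fun hv => hc ?_)
    exact Nat.pos_of_ne_zero (mem_vars_iff_degreeOf_ne_zero.1 hv)
  have : degreeOf i (pderiv i p) < degreeOf i p := by
    rw [degreeOf_lt_iff hpos]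
    intro m hm
    rw [mem_support_iff, coeff_pderiv] at hm
    have := monomial_le_degreeOf i (mem_support_iff.2 (left_ne_zero_of_mul hm))
    simp at this
    omega
  omega

theorem X_two_dvd_sub (g : S3) :
    X 2 ∣ g - aeval (fun i : Fin 3 => if i = 2 then (0 : S3) else X i) g := by
  rw [← Ideal.mem_span_singleton, ← Ideal.Quotient.eq]
  have : Ideal.Quotient.mkₐ ℂ (Ideal.span {(X 2 : S3)}) =
      (Ideal.Quotient.mkₐ ℂ (Ideal.span {(X 2 : S3)})).comp
        (aeval (fun i : Fin 3 => if i = 2 then (0 : S3) else X i)) := by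
    ext i
    by_cases hi : i = 2
    · subst hi
      simp only [AlgHom.comp_apply, aeval_X, if_true, map_zero]
      exact Ideal.Quotient.eq_zero_iff_mem.2 (Ideal.mem_span_singleton_self _)
    · simp [hi]
  exact DFunLike.congr_fun this g

/-- Exactness of the Koszul complex on the three variables. -/
theorem koszul_exact {a : Fin 3 → S3} (h : X 0 * a 0 + X 1 * a 1 + X 2 * a 2 = 0) :
    ∃ b : Fin 3 → S3, a 0 = X 2 * b 1 - X 1 * b 2 ∧ a 1 = X 0 * b 2 - X 2 * b 0 ∧
      a 2 = X 1 * b 0 - X 0 * b 1 := by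
  obtain ⟨e₀, h₀⟩ := X_two_dvd_sub (a 0)
  obtain ⟨e₁, h₁⟩ := X_two_dvd_sub (a 1)
  set π := aeval (R := ℂ) (fun i : Fin 3 => if i = 2 then (0 : S3) else X i) with hπ
  have hx : (X 0 : S3) ≠ 0 := X_ne_zero 0
  have hz : (X 2 : S3) ≠ 0 := X_ne_zero 2
  have hsub : X 0 * π (a 0) + X 1 * π (a 1) = 0 := by
    have := congrArg π h
    simpa [hπ] using this
  have hdvd : (X 0 : S3) ∣ X 1 * π (a 1) := ⟨-π (a 0), by linear_combination hsub⟩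
  obtain ⟨c, hc⟩ := (X_dvd_mul_iff.1 hdvd).resolve_left
    (by rw [X_dvd_X]; simp)
  have hc' : π (a 0) = - (X 1 * c) := by
    apply mul_left_cancel₀ hx
    linear_combination hsub - X 1 * hc
  refine ⟨![-e₁, e₀, c], ?_, ?_, ?_⟩
  · simp; linear_combination h₀ + hc'
  · simp; linear_combination h₁ + hc
  · simp
    apply mul_left_cancel₀ hz
    linear_combination h - X 0 * (h₀ + hc') - X 1 * (h₁ + hc)

theorem finrank_homogeneousSubmodule (n : ℕ) :
    Module.finrank ℂ (homogeneousSubmodule (Fin 3) ℂ n) = (n + 2).choose 2 := by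
  have e : homogeneousSubmodule (Fin 3) ℂ n ≃ₗ[ℂ] ({d : Fin 3 →₀ ℕ | d.degree = n} →₀ ℂ) :=
    (LinearEquiv.ofEq _ _ (homogeneousSubmodule_eq_finsupp_supported _ _ n)).trans
      (AddMonoidAlgebra.supportedEquivFinsupp _)
  have e' : {d : Fin 3 →₀ ℕ | d.degree = n} ≃ Sym (Fin 3) n :=
    (Equiv.subtypeEquivRight fun d => by
      simp [Finsupp.degree_eq_sum, Finsupp.sum_fintype]).trans (Sym.equivNatSum (Fin 3) n).symm
  have := Fintype.ofEquiv _ e'.symm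
  rw [e.finrank_eq, Module.finrank_finsupp_self, Fintype.card_congr e', Sym.card_sym_eq_choose,
    Fintype.card_fin, show 3 + n - 1 = n + 2 by omega, Nat.choose_symm_add]

instance finite_homogeneousSubmodule (n : ℕ) :
    Module.Finite ℂ (homogeneousSubmodule (Fin 3) ℂ n) :=
  Module.Finite.iff_fg.2 (homogeneousSubmodule_fg _ _ n)

/-! ### The gradient and Jacobian syzygies -/

/-- The vector of partial derivatives of `f`. -/
def grad (f : S3) : Fin 3 → S3 := fun i => pderiv i f

open Matrix in
theorem mem_jacSyz_iff {f : S3} {v : Fin 3 → S3} : v ∈ jacSyz f ↔ v ⬝ᵥ grad f = 0 := by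
  rw [dotProduct, Fin.sum_univ_three]
  exact Iff.rfl

theorem grad_ne_zero {f : S3} {d : ℕ} (hd : d ≠ 0) (hf : f.IsHomogeneous d) (hf0 : f ≠ 0) :
    grad f ≠ 0 := by
  intro h
  have he := hf.sum_X_mul_pderiv
  rw [Finset.sum_eq_zero fun i _ => by rw [show pderiv i f = 0 from congrFun h i, mul_zero]] at he
  rw [eq_comm, smul_eq_zero] at he
  exact he.elim hd hf0

/-- The partial derivatives of a reduced homogeneous polynomial have no common factor. -/
theorem exists_not_dvd_grad {f : S3} {d : ℕ} (hd : d ≠ 0) (hf : f.IsHomogeneous d)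
    (hred : Squarefree f) {p : S3} (hp : Prime p) : ∃ i, ¬ p ∣ grad f i := by
  by_contra! h
  have hpf : p ∣ f := by
    have hs : p ∣ (d : ℂ) • f := by
      rw [Nat.cast_smul_eq_nsmul, ← hf.sum_X_mul_pderiv]
      exact Finset.dvd_sum fun i _ => (h i).mul_left _
    have h' := hs.trans (Dvd.intro_left (C (d : ℂ)⁻¹) rfl)
    rwa [← smul_eq_C_mul, smul_smul, inv_mul_cancel₀ (by exact_mod_cast hd), one_smul] at h'
  obtain ⟨q, rfl⟩ := hpf
  have hpq : ¬ p ∣ q := fun hq => hp.not_isUnit (hred p (mul_dvd_mul_left p hq))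
  refine hp.not_isUnit (isUnit_of_forall_pderiv_eq_zero hp.ne_zero fun i =>
    pderiv_eq_zero_of_dvd ?_)
  have hi := h i
  rw [grad, pderiv_mul] at hi
  exact (hp.dvd_or_dvd ((dvd_add_left (dvd_mul_right _ _)).1 hi)).resolve_right hpq

/-- The degree `n` part of a vector of polynomials. -/
def vecComponent (n : ℕ) (v : Fin 3 → S3) : Fin 3 → S3 := fun i => homogeneousComponent n (v i)

theorem vecComponent_of_isHomogeneous {v : Fin 3 → S3} {n : ℕ} (hv : ∀ i, (v i).IsHomogeneous n) :
    vecComponent n v = v :=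
  funext fun i => homogeneousComponent_eq_self (hv i)

theorem sum_mul_homogeneousComponent {n e : ℕ} {a F : Fin 3 → S3}
    (hF : ∀ i, (F i).IsHomogeneous e) :
    ∑ i, homogeneousComponent n (a i) * F i = homogeneousComponent (e + n) (∑ i, a i * F i) := by
  rw [map_sum]
  refine Finset.sum_congr rfl fun i _ => ?_
  rw [mul_comm (a i), homogeneousComponent_add_mul (hF i), mul_comm]

theorem vecComponent_mem_jacSyz {f : S3} {e : ℕ} (hF : ∀ i, (grad f i).IsHomogeneous e)
    {v : Fin 3 → S3} (hv : v ∈ jacSyz f) (n : ℕ) : vecComponent n v ∈ jacSyz f := by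
  rw [mem_jacSyz_iff] at hv ⊢
  refine (sum_mul_homogeneousComponent hF).trans ?_
  rw [show ∑ i, v i * grad f i = 0 from hv, map_zero]

open Matrix in
theorem vecComponent_cross {v : Fin 3 → S3} {r : ℕ} (hv : ∀ i, (v i).IsHomogeneous r)
    (w : Fin 3 → S3) (n : ℕ) : v ⨯₃ vecComponent n w = vecComponent (r + n) (v ⨯₃ w) := by
  funext i
  fin_cases i <;>
    simp [cross_apply, vecComponent, homogeneousComponent_add_mul (hv _)]

theorem vecComponent_smul {F : Fin 3 → S3} {e : ℕ} (hF : ∀ i, (F i).IsHomogeneous e)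
    (g : S3) (n : ℕ) : vecComponent (e + n) (g • F) = homogeneousComponent n g • F := by
  funext i
  simp [vecComponent, mul_comm _ (F i), homogeneousComponent_add_mul (hF i)]

theorem smul_injective_of_ne_zero {F : Fin 3 → S3} (hF : F ≠ 0) {a b : S3} (h : a • F = b • F) :
    a = b := by
  obtain ⟨i, hi⟩ := Function.ne_iff.1 hF
  exact mul_right_cancel₀ hi (congrFun h i)

/-- A nonzero Jacobian syzygy of minimal degree of a reduced curve is primitive. -/
theorem exists_not_dvd_of_isMDR {f : S3} {e r : ℕ} (hF : ∀ i, (grad f i).IsHomogeneous e)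
    (hmdr : IsMDR f r) {v : Fin 3 → S3} (hv : v ∈ jacSyz f) (hr : ∀ i, (v i).IsHomogeneous r)
    (hv0 : v ≠ 0) {p : S3} (hp : Prime p) : ∃ i, ¬ p ∣ v i := by
  by_contra! h
  choose u hu using h
  have hvu : v = p • u := funext hu
  have hum : u ∈ jacSyz f := by
    rw [mem_jacSyz_iff, hvu, smul_dotProduct, smul_eq_zero] at hv
    exact mem_jacSyz_iff.2 (hv.resolve_left hp.ne_zero)
  obtain ⟨i, hi⟩ := Function.ne_iff.1 hv0
  have hui : u i ≠ 0 := fun h0 => hi (by rw [hu, h0, mul_zero, Pi.zero_apply])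
  have hdeg : r = p.totalDegree + (u i).totalDegree := by
    rw [← (hr i).totalDegree hi, hu, totalDegree_mul_of_isDomain hp.ne_zero hui]
  have hle : r ≤ (u i).totalDegree := by
    by_contra! hlt
    refine hui (ext_homogeneousComponent fun n => ?_)
    rw [map_zero]
    rcases lt_or_ge n r with hn | hn
    · exact congrFun (hmdr.2 n hn _ (vecComponent_mem_jacSyz hF hum n)
        fun i => homogeneousComponent_isHomogeneous n _) i
    · exact homogeneousComponent_eq_zero _ _ (by omega)
  have hpC := totalDegree_eq_zero_iff_eq_C.1 (show p.totalDegree = 0 by omega)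
  refine hp.not_isUnit ?_
  rw [hpC]
  refine (isUnit_iff_ne_zero.2 fun h0 => hp.ne_zero ?_).map C
  rw [hpC, h0, C_0]

theorem mdr_le {f : S3} {e r : ℕ} (hF : ∀ i, (grad f i).IsHomogeneous e) (hF0 : grad f ≠ 0)
    (hmdr : IsMDR f r) : r ≤ e := by
  by_contra! hlt
  have h1 := hmdr.2 e hlt ![grad f 1, -grad f 0, 0]
    (by rw [mem_jacSyz_iff, dotProduct, Fin.sum_univ_three]; simp; ring)
    (by intro i; fin_cases i
        exacts [hF 1, (hF 0).neg, isHomogeneous_zero _ _ _])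
  have h2 := hmdr.2 e hlt ![grad f 2, 0, -grad f 0]
    (by rw [mem_jacSyz_iff, dotProduct, Fin.sum_univ_three]; simp; ring)
    (by intro i; fin_cases i
        exacts [hF 2, isHomogeneous_zero _ _ _, (hF 0).neg])
  refine hF0 (funext fun i => ?_)
  fin_cases i
  · simpa using congrFun h1 1
  · simpa using congrFun h1 0
  · simpa using congrFun h2 0

/-- `v` is a primitive Jacobian syzygy of degree `r` of `f`, whose partial derivatives are coprime
forms of degree `e ≥ r`. -/
structure IsPrimSyz (f : S3) (e r : ℕ) (v : Fin 3 → S3) : Prop where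
  grad_hom : ∀ i, (grad f i).IsHomogeneous e
  grad_ne_zero : grad f ≠ 0
  grad_prim : ∀ p, Prime p → ∃ i, ¬ p ∣ grad f i
  mem : v ∈ jacSyz f
  hom : ∀ i, (v i).IsHomogeneous r
  ne_zero : v ≠ 0
  prim : ∀ p, Prime p → ∃ i, ¬ p ∣ v i
  le : r ≤ e

open Matrix

/-- The Bourbaki ideal of `f` with respect to the syzygy `v`: the ideal of all `g` such that
`v ⨯₃ w = g • grad f` for some Jacobian syzygy `w`. -/
def bourbakiIdeal (f : S3) (v : Fin 3 → S3) : Ideal S3 where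
  carrier := {g | ∃ w ∈ jacSyz f, v ⨯₃ w = g • grad f}
  add_mem' := by
    rintro a b ⟨w, hw, h⟩ ⟨w', hw', h'⟩
    exact ⟨w + w', add_mem hw hw', by rw [map_add, h, h', add_smul]⟩
  zero_mem' := ⟨0, zero_mem _, by simp⟩
  smul_mem' := by
    rintro c a ⟨w, hw, h⟩
    exact ⟨c • w, Submodule.smul_mem _ _ hw, by rw [map_smul, h, smul_assoc]⟩

namespace IsPrimSyz

variable {f : S3} {e r : ℕ} {v : Fin 3 → S3}

theorem exists_cross_eq (H : IsPrimSyz f e r v) {w : Fin 3 → S3} (hw : w ∈ jacSyz f) :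
    ∃ g : S3, v ⨯₃ w = g • grad f := by
  apply exists_eq_smul_of_cross_eq_zero H.grad_prim H.grad_ne_zero
  have h1 := mem_jacSyz_iff.1 H.mem
  have h2 := mem_jacSyz_iff.1 hw
  rw [← cross_anticomm, cross_cross_eq_smul_sub_smul, h1, h2]
  simp

theorem eq_smul (H : IsPrimSyz f e r v) {w : Fin 3 → S3} (h : v ⨯₃ w = 0) : ∃ s : S3, w = s • v :=
  exists_eq_smul_of_cross_eq_zero H.prim H.ne_zero h

/-- A form in the Bourbaki ideal comes from a homogeneous syzygy. -/
theorem exists_homogeneous (H : IsPrimSyz f e r v) {g : S3} (hg : g ∈ bourbakiIdeal f v)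
    {n j : ℕ} (hj : r + j = e + n) : ∃ w ∈ jacSyz f, (∀ i, (w i).IsHomogeneous j) ∧
      v ⨯₃ w = homogeneousComponent n g • grad f := by
  obtain ⟨w, hw, h⟩ := hg
  refine ⟨vecComponent j w, vecComponent_mem_jacSyz H.grad_hom hw j,
    fun i => homogeneousComponent_isHomogeneous _ _, ?_⟩
  rw [vecComponent_cross H.hom, h, hj, vecComponent_smul H.grad_hom]

theorem homogeneousComponent_mem (H : IsPrimSyz f e r v) {g : S3} (hg : g ∈ bourbakiIdeal f v)
    (n : ℕ) : homogeneousComponent n g ∈ bourbakiIdeal f v := by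
  have := H.le
  obtain ⟨w, hw, -, h⟩ := H.exists_homogeneous hg (show r + (e + n - r) = e + n by omega)
  exact ⟨w, hw, h⟩

theorem isHomogeneous_of_cross_eq (H : IsPrimSyz f e r v) {w : Fin 3 → S3} {g : S3} {n j : ℕ}
    (hw : ∀ i, (w i).IsHomogeneous j) (h : v ⨯₃ w = g • grad f) (hj : r + j = e + n) :
    g.IsHomogeneous n := by
  have h' := vecComponent_cross H.hom w j
  rw [vecComponent_of_isHomogeneous hw, h, hj, vecComponent_smul H.grad_hom] at h'
  rw [smul_injective_of_ne_zero H.grad_ne_zero h']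
  exact homogeneousComponent_isHomogeneous n g

/-- The Bourbaki ideal is saturated. -/
theorem mem_of_forall_X_mul_mem (H : IsPrimSyz f e r v) {g : S3}
    (hg : ∀ i, X i * g ∈ bourbakiIdeal f v) : g ∈ bourbakiIdeal f v := by
  choose w hw hvw using hg
  have hcross : ∀ i j, ∃ s : S3, (X j : S3) • w i - (X i : S3) • w j = s • v := fun i j => H.eq_smul <| by
    rw [map_sub, map_smul, map_smul, hvw i, hvw j, smul_smul, smul_smul, ← sub_smul]
    rw [show (X j : S3) * (X i * g) - X i * (X j * g) = 0 by ring, zero_smul]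
  obtain ⟨a₀, h₀⟩ := hcross 1 2
  obtain ⟨a₁, h₁⟩ := hcross 2 0
  obtain ⟨a₂, h₂⟩ := hcross 0 1
  obtain ⟨b, hb₀, hb₁, hb₂⟩ := koszul_exact (a := ![a₀, a₁, a₂]) (by
    apply smul_injective_of_ne_zero H.ne_zero
    simp only [cons_val, add_smul, mul_smul, ← h₀, ← h₁, ← h₂, zero_smul]
    module)
  simp only [cons_val] at hb₀ hb₁ hb₂
  have e₂ : ∀ k, X 1 * (w 0 k - b 0 * v k) = X 0 * (w 1 k - b 1 * v k) := fun k => by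
    have := congrFun h₂ k
    simp only [hb₂, Pi.sub_apply, Pi.smul_apply, smul_eq_mul] at this
    linear_combination this
  have hdvd : ∀ k, ∃ u, w 0 k - b 0 * v k = X 0 * u := fun k =>
    (X_dvd_mul_iff.1 ⟨_, e₂ k⟩).resolve_left (by rw [X_dvd_X]; simp)
  choose u hu using hdvd
  have hw0 : w 0 = b 0 • v + (X 0 : S3) • u := funext fun k => by
    simp only [Pi.add_apply, Pi.smul_apply, smul_eq_mul]
    linear_combination hu k
  have hx : (X 0 : S3) ≠ 0 := X_ne_zero 0
  refine ⟨u, ?_, ?_⟩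
  · have h := mem_jacSyz_iff.1 (hw 0)
    rw [hw0, add_dotProduct, smul_dotProduct, smul_dotProduct, mem_jacSyz_iff.1 H.mem, smul_zero,
      zero_add, smul_eq_zero] at h
    exact mem_jacSyz_iff.2 (h.resolve_left hx)
  · have h := hvw 0
    rw [hw0, map_add, map_smul, map_smul, cross_self, smul_zero, zero_add, mul_smul] at h
    exact smul_right_injective _ hx h

theorem mem_of_forall_isHomogeneous_mul_mem (H : IsPrimSyz f e r v) {q : S3} (n : ℕ)
    (hq : ∀ u : S3, u.IsHomogeneous n → u * q ∈ bourbakiIdeal f v) : q ∈ bourbakiIdeal f v := by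
  induction n with
  | zero => simpa using hq 1 (isHomogeneous_one _ _)
  | succ n ih =>
    refine ih fun u hu => H.mem_of_forall_X_mul_mem fun i => ?_
    rw [← mul_assoc]
    exact hq _ (by rw [add_comm]; exact (isHomogeneous_X _ i).mul hu)

end IsPrimSyz

/-! ### Hilbert functions -/

/-- The Hilbert function of `S / I`. -/
def hilbQuot (I : Ideal S3) (n : ℕ) : ℕ :=
  Module.finrank ℂ
    (↥(homogeneousSubmodule (Fin 3) ℂ n) ⧸
      (Submodule.comap (homogeneousSubmodule (Fin 3) ℂ n).subtype
        (Submodule.restrictScalars ℂ I)))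

/-- The forms of degree `n` in the ideal `I`. -/
def degreePart (I : Ideal S3) (n : ℕ) : Submodule ℂ S3 :=
  homogeneousSubmodule (Fin 3) ℂ n ⊓ Submodule.restrictScalars ℂ I

theorem hilbQuot_add_finrank (I : Ideal S3) (n : ℕ) :
    hilbQuot I n + Module.finrank ℂ (degreePart I n) = (n + 2).choose 2 := by
  rw [← finrank_homogeneousSubmodule, degreePart, ← Submodule.map_comap_subtype,
    Submodule.finrank_map_subtype_eq]
  exact Submodule.finrank_quotient_add_finrank _

theorem finrank_map_add_finrank_inf_ker {K V W : Type*} [Field K] [AddCommGroup V] [Module K V]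
    [AddCommGroup W] [Module K W] (g : V →ₗ[K] W) (p : Submodule K V) [FiniteDimensional K p] :
    Module.finrank K (p.map g) + Module.finrank K (p ⊓ LinearMap.ker g : Submodule K V) =
      Module.finrank K p := by
  rw [← LinearMap.finrank_range_add_finrank_ker (g.domRestrict p), LinearMap.range_domRestrict,
    LinearMap.ker_domRestrict, ← Submodule.map_comap_subtype, Submodule.finrank_map_subtype_eq]

theorem finrank_map_of_injective {K V W : Type*} [Field K] [AddCommGroup V] [Module K V]
    [AddCommGroup W] [Module K W] {g : V →ₗ[K] W} (hg : Function.Injective g)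
    (p : Submodule K V) : Module.finrank K (p.map g) = Module.finrank K p :=
  (Submodule.equivMapOfInjective g hg p).finrank_eq.symm

/-- The vectors of forms of degree `n`. -/
def vecForms (n : ℕ) : Submodule ℂ (Fin 3 → S3) :=
  LinearMap.range ((homogeneousSubmodule (Fin 3) ℂ n).subtype.compLeft (Fin 3))

theorem mem_vecForms {n : ℕ} {v : Fin 3 → S3} : v ∈ vecForms n ↔ ∀ i, (v i).IsHomogeneous n := by
  constructor
  · rintro ⟨u, rfl⟩ i
    exact (u i).2
  · exact fun h => ⟨fun i => ⟨v i, h i⟩, rfl⟩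

instance finite_vecForms (n : ℕ) : Module.Finite ℂ (vecForms n) := by
  unfold vecForms
  infer_instance

theorem finrank_vecForms (n : ℕ) : Module.finrank ℂ (vecForms n) = 3 * (n + 2).choose 2 := by
  rw [vecForms, LinearMap.finrank_range_of_inj, Module.finrank_pi_fintype]
  · simp [finrank_homogeneousSubmodule]
  · exact fun a b h => funext fun i => Subtype.ext (congrFun h i)

/-- The pairing with the gradient, as a linear map over `ℂ`. -/
def gradPairing (f : S3) : (Fin 3 → S3) →ₗ[ℂ] S3 where
  toFun v := v ⬝ᵥ grad f
  map_add' _ _ := add_dotProduct _ _ _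
  map_smul' _ _ := smul_dotProduct _ _ _

theorem map_gradPairing {f : S3} {e : ℕ} (hF : ∀ i, (grad f i).IsHomogeneous e) (j : ℕ) :
    (vecForms j).map (gradPairing f) = degreePart (jacobianIdeal f) (e + j) := by
  ext x
  constructor
  · rintro ⟨v, hv, rfl⟩
    have hv' := mem_vecForms.1 hv
    refine ⟨IsHomogeneous.sum _ _ _ fun i _ => ?_, ?_⟩
    · rw [add_comm]
      exact (hv' i).mul (hF i)
    · change ∑ i, v i * grad f i ∈ jacobianIdeal f
      refine (jacobianIdeal f).sum_mem fun i _ =>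
        (jacobianIdeal f).mul_mem_left _ (Ideal.subset_span ?_)
      fin_cases i <;> simp [grad]
  · rintro ⟨hx, hJ⟩
    obtain ⟨a, b, c, habc⟩ := Submodule.mem_span_triple.1 hJ
    refine ⟨vecComponent j ![a, b, c],
      mem_vecForms.2 fun i => homogeneousComponent_isHomogeneous _ _, ?_⟩
    refine (sum_mul_homogeneousComponent hF).trans ?_
    rw [Fin.sum_univ_three, ← homogeneousComponent_eq_self hx]
    congr 1

/-- The product of a scalar polynomial with a fixed vector, as a linear map over `ℂ`. -/
def smulVec (F : Fin 3 → S3) : S3 →ₗ[ℂ] (Fin 3 → S3) where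
  toFun g := g • F
  map_add' _ _ := add_smul _ _ _
  map_smul' _ _ := smul_assoc _ _ _

theorem smulVec_injective {F : Fin 3 → S3} (hF : F ≠ 0) : Function.Injective (smulVec F) :=
  fun _ _ h => smul_injective_of_ne_zero hF h

namespace IsPrimSyz

variable {f : S3} {e r : ℕ} {v : Fin 3 → S3}

theorem map_cross (H : IsPrimSyz f e r v) {n j : ℕ} (hj : r + j = e + n) :
    (vecForms j ⊓ LinearMap.ker (gradPairing f)).map ((crossProduct v).restrictScalars ℂ) =
      (degreePart (bourbakiIdeal f v) n).map (smulVec (grad f)) := by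
  ext x
  constructor
  · rintro ⟨w, ⟨hw, hw'⟩, rfl⟩
    have hmem : w ∈ jacSyz f := mem_jacSyz_iff.2 hw'
    obtain ⟨g, hg⟩ := H.exists_cross_eq hmem
    exact ⟨g, ⟨H.isHomogeneous_of_cross_eq (mem_vecForms.1 hw) hg hj, w, hmem, hg⟩, hg.symm⟩
  · rintro ⟨g, ⟨hg, hgI⟩, rfl⟩
    obtain ⟨w, hw, hwj, h⟩ := H.exists_homogeneous hgI hj
    rw [homogeneousComponent_eq_self hg] at h
    exact ⟨w, ⟨mem_vecForms.2 hwj, mem_jacSyz_iff.1 hw⟩, h⟩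

theorem inf_ker_cross (H : IsPrimSyz f e r v) (m : ℕ) :
    vecForms (r + m) ⊓ LinearMap.ker (gradPairing f) ⊓
        LinearMap.ker ((crossProduct v).restrictScalars ℂ) =
      (homogeneousSubmodule (Fin 3) ℂ m).map (smulVec v) := by
  ext w
  constructor
  · rintro ⟨⟨hw, -⟩, hc⟩
    obtain ⟨s, rfl⟩ := H.eq_smul hc
    refine ⟨homogeneousComponent m s, homogeneousComponent_isHomogeneous _ _, ?_⟩
    exact (vecComponent_smul H.hom s m).symm.trans
      (vecComponent_of_isHomogeneous (mem_vecForms.1 hw))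
  · rintro ⟨s, hs, rfl⟩
    refine ⟨⟨mem_vecForms.2 fun i => ?_, ?_⟩, ?_⟩
    · rw [add_comm]
      exact IsHomogeneous.mul hs (H.hom i)
    · exact mem_jacSyz_iff.1 (Submodule.smul_mem _ s H.mem)
    · change v ⨯₃ (s • v) = 0
      rw [map_smul, cross_self, smul_zero]

theorem milnorDim_add_hilbQuot (H : IsPrimSyz f e r v) {n j m k : ℕ} (hj : r + j = e + n)
    (hm : j = r + m) (hk : k = e + j) :
    milnorDim f k + hilbQuot (bourbakiIdeal f v) n + 3 * (j + 2).choose 2 =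
      (k + 2).choose 2 + (m + 2).choose 2 + (n + 2).choose 2 := by
  have h1 := hilbQuot_add_finrank (jacobianIdeal f) k
  have h2 := hilbQuot_add_finrank (bourbakiIdeal f v) n
  have h3 := finrank_map_add_finrank_inf_ker (gradPairing f) (vecForms j)
  have h4 := finrank_map_add_finrank_inf_ker ((crossProduct v).restrictScalars ℂ)
    (vecForms j ⊓ LinearMap.ker (gradPairing f))
  rw [map_gradPairing H.grad_hom, ← hk, finrank_vecForms] at h3
  rw [H.map_cross hj, finrank_map_of_injective (smulVec_injective H.grad_ne_zero), hm,
    H.inf_ker_cross, finrank_map_of_injective (smulVec_injective H.ne_zero),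
    finrank_homogeneousSubmodule, ← hm] at h4
  have h5 : milnorDim f k = hilbQuot (jacobianIdeal f) k := rfl
  omega

/-- The Hilbert function of the quotient by the Bourbaki ideal measures the defect of the total
Tjurina number from its maximal possible value. -/
theorem eventually_hilbQuot (H : IsPrimSyz f e r v) {τ : ℕ} (hτ : IsTjurina f τ) :
    ∀ᶠ n in Filter.atTop,
      (τ : ℤ) + hilbQuot (bourbakiIdeal f v) n = (e : ℤ) ^ 2 - r * (e - r) := by
  obtain ⟨N, hN⟩ := Filter.eventually_atTop.1 hτ
  obtain ⟨t, rfl⟩ := Nat.exists_eq_add_of_le H.le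
  refine Filter.eventually_atTop.2 ⟨N + r, fun n hn => ?_⟩
  obtain ⟨s, rfl⟩ := Nat.exists_eq_add_of_le (show r ≤ n by omega)
  have key := H.milnorDim_add_hilbQuot (n := r + s) (j := r + (s + t)) (m := s + t)
    (k := r + t + (r + (s + t))) (by ring) rfl rfl
  rw [hN _ (by omega)] at key
  have h2 : ∀ x : ℕ, 2 * ((x + 2).choose 2 : ℤ) = (x + 2) * (x + 1) := fun x => by
    have h' := Nat.add_one_mul_choose_eq (x + 1) 1
    rw [Nat.choose_one_right] at h'
    norm_cast
    linarith
  have ha := h2 (r + (s + t))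
  have hb := h2 (r + t + (r + (s + t)))
  have hc := h2 (s + t)
  have hd := h2 (r + s)
  zify at key
  push_cast at ha hb hc hd ⊢
  have : (2 : ℤ) * (τ + hilbQuot (bourbakiIdeal f v) (r + s)) =
      2 * (((r : ℤ) + t) ^ 2 - r * (r + t - r)) := by
    linear_combination 2 * key - 3 * ha + hb + hc + hd
  linarith

end IsPrimSyz

/-! ### The homogeneous ideal of a point -/

/-- The linear form with coefficient vector `a`. -/
def linForm (a : Fin 3 → ℂ) : S3 := ∑ i, C (a i) * X i

theorem isHomogeneous_linForm (a : Fin 3 → ℂ) : (linForm a).IsHomogeneous 1 :=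
  IsHomogeneous.sum _ _ _ fun i _ => isHomogeneous_C_mul_X (a i) i

theorem eval_linForm (a p : Fin 3 → ℂ) : eval p (linForm a) = a ⬝ᵥ p := by
  simp [linForm, dotProduct]

theorem linForm_injective : Function.Injective linForm := fun a b h => funext fun i => by
  simpa [eval_linForm] using congrArg (eval (Pi.single i 1)) h

theorem linForm_add (a b : Fin 3 → ℂ) : linForm (a + b) = linForm a + linForm b := by
  simp [linForm, add_mul, Finset.sum_add_distrib]

theorem linForm_smul (c : ℂ) (a : Fin 3 → ℂ) : linForm (c • a) = C c * linForm a := by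
  simp [linForm, Finset.mul_sum, mul_assoc]

theorem linForm_zero : linForm 0 = 0 := by simp [linForm]

theorem cross_eq_zero_of_linForm_dvd {a b : Fin 3 → ℂ} (h : linForm b ∣ linForm a) :
    a ⨯₃ b = 0 := by
  obtain ⟨t, ht⟩ := h
  have h1 := homogeneousComponent_add_mul (isHomogeneous_linForm b) 0 t
  rw [← ht, add_zero, homogeneousComponent_eq_self (isHomogeneous_linForm a),
    homogeneousComponent_zero, mul_comm, ← linForm_smul] at h1
  rw [linForm_injective h1, map_smul, LinearMap.smul_apply, cross_self, smul_zero]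

/-- Modulo an ideal in which every variable is the multiple `p i * l` of a form `l`, a form is
determined by its value at `p`. -/
theorem sub_eval_mul_pow_mem {I : Ideal S3} {l : S3} {p : Fin 3 → ℂ}
    (h : ∀ i, X i - C (p i) * l ∈ I) {g : S3} {n : ℕ} (hg : g.IsHomogeneous n) :
    g - C (eval p g) * l ^ n ∈ I := by
  rw [← Ideal.Quotient.eq]
  have hX : ∀ i, Ideal.Quotient.mk I (X i) = Ideal.Quotient.mk I (C (p i) * l) :=
    fun i => Ideal.Quotient.eq.2 (h i)
  conv_lhs => rw [← eval₂_eta g, eval₂_eq']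
  rw [eval_eq', map_sum C, Finset.sum_mul, map_sum, map_sum]
  refine Finset.sum_congr rfl fun m hm => ?_
  have hdeg : n = ∑ i, m i := by
    rw [hg.degree_eq_sum_deg_support hm]
    exact Finset.sum_subset (Finset.subset_univ _) (by simp)
  simp only [map_mul, map_prod, map_pow, hX, mul_pow, Finset.prod_mul_distrib, mul_assoc, hdeg,
    Finset.prod_pow_eq_pow_sum]

theorem exists_sub_mem_span_pair {a b : Fin 3 → ℂ} (hab : a ⨯₃ b ≠ 0) :
    ∃ l : S3, l.IsHomogeneous 1 ∧ eval (a ⨯₃ b) l = 1 ∧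
      ∀ i, X i - C ((a ⨯₃ b) i) * l ∈ Ideal.span {linForm a, linForm b} := by
  obtain ⟨j, hj⟩ := Function.ne_iff.1 hab
  rw [Pi.zero_apply] at hj
  refine ⟨C ((a ⨯₃ b) j)⁻¹ * X j, isHomogeneous_C_mul_X _ _, by simp [hj], fun i => ?_⟩
  have key : C ((a ⨯₃ b) j) * X i - C ((a ⨯₃ b) i) * X j ∈
      Ideal.span {linForm a, linForm b} := by
    let c : Fin 3 → ℂ := Pi.single i 1 ⨯₃ Pi.single j 1
    refine Ideal.mem_span_pair.2 ⟨C (-(b ⬝ᵥ c)), C (a ⬝ᵥ c), ?_⟩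
    simp only [c, linForm, cross_apply, dotProduct, Fin.sum_univ_three]
    clear hj c
    fin_cases i <;> fin_cases j <;> simp <;> ring
  have := Ideal.mul_mem_left _ (C ((a ⨯₃ b) j)⁻¹) key
  convert this using 1
  have hC : (C ((a ⨯₃ b) j)⁻¹ : S3) * C ((a ⨯₃ b) j) = 1 := by
    rw [← C_mul, inv_mul_cancel₀ hj, C_1]
  linear_combination -X i * hC

theorem mem_span_pair_iff_eval_eq_zero {a b : Fin 3 → ℂ} (hab : a ⨯₃ b ≠ 0) {g : S3} {n : ℕ}
    (hg : g.IsHomogeneous n) :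
    g ∈ Ideal.span {linForm a, linForm b} ↔ eval (a ⨯₃ b) g = 0 := by
  constructor
  · intro h
    obtain ⟨s, t, rfl⟩ := Ideal.mem_span_pair.1 h
    simp [eval_linForm, dot_self_cross, dot_cross_self]
  · intro h
    obtain ⟨l, -, -, hl⟩ := exists_sub_mem_span_pair hab
    simpa [h] using sub_eval_mul_pow_mem hl hg

theorem hilbQuot_span_pair {a b : Fin 3 → ℂ} (hab : a ⨯₃ b ≠ 0) (n : ℕ) :
    hilbQuot (Ideal.span {linForm a, linForm b}) n = 1 := by
  obtain ⟨l, hl1, hl, -⟩ := exists_sub_mem_span_pair hab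
  let φ : homogeneousSubmodule (Fin 3) ℂ n →ₗ[ℂ] ℂ :=
    (aeval (R := ℂ) (a ⨯₃ b)).toLinearMap.comp (homogeneousSubmodule (Fin 3) ℂ n).subtype
  have hφ : ∀ g, φ g = eval (a ⨯₃ b) g.1 := fun g => by simp [φ, aeval_eq_eval]
  have hsurj : Function.Surjective φ := fun c => by
    refine ⟨⟨C c * l ^ n, by simpa using (hl1.pow n).C_mul c⟩, ?_⟩
    simp [hφ, hl]
  have hker : Submodule.comap (homogeneousSubmodule (Fin 3) ℂ n).subtype
      (Submodule.restrictScalars ℂ (Ideal.span {linForm a, linForm b})) = LinearMap.ker φ := by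
    ext g
    rw [LinearMap.mem_ker, hφ, ← mem_span_pair_iff_eval_eq_zero hab g.2]
    rfl
  rw [hilbQuot, hker, (φ.quotKerEquivOfSurjective hsurj).finrank_eq, Module.finrank_self]

theorem exists_cross_eq_of_ne_zero {p : Fin 3 → ℂ} (hp : p ≠ 0) :
    ∃ a b : Fin 3 → ℂ, a ⨯₃ b = p := by
  obtain ⟨j, hj⟩ := Function.ne_iff.1 hp
  fin_cases j
  · refine ⟨![-p 1 / p 0, 1, 0], ![-p 2, 0, p 0], ?_⟩
    funext i
    fin_cases i <;> (simp [cross_apply]; try field_simp [show p 0 ≠ 0 from hj])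
  · refine ⟨![0, -p 2 / p 1, 1], ![p 1, -p 0, 0], ?_⟩
    funext i
    fin_cases i <;> (simp [cross_apply]; try field_simp [show p 1 ≠ 0 from hj])
  · refine ⟨![1, 0, -p 0 / p 2], ![0, p 2, -p 1], ?_⟩
    funext i
    fin_cases i <;> (simp [cross_apply]; try field_simp [show p 2 ≠ 0 from hj])

/-- In a degree where `S / I` is one-dimensional, any two forms are proportional modulo `I`. -/
theorem exists_sub_C_mul_mem {I : Ideal S3} {n : ℕ} (h : hilbQuot I n = 1) {u g : S3}
    (hu : u.IsHomogeneous n) (huI : u ∉ I) (hg : g.IsHomogeneous n) : ∃ c : ℂ, g - C c * u ∈ I := by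
  let P := Submodule.comap (homogeneousSubmodule (Fin 3) ℂ n).subtype
    (Submodule.restrictScalars ℂ I)
  have hu0 : P.mkQ ⟨u, hu⟩ ≠ 0 := fun h0 => huI ((Submodule.Quotient.mk_eq_zero P).1 h0)
  obtain ⟨c, hc⟩ := (finrank_eq_one_iff_of_nonzero' _ hu0).1 h (P.mkQ ⟨g, hg⟩)
  refine ⟨c, ?_⟩
  rw [← map_smul] at hc
  have := (Submodule.Quotient.eq P).1 hc.symm
  rw [← smul_eq_C_mul]
  exact this

theorem exists_notMem_of_hilbQuot_eq_one {I : Ideal S3} {n : ℕ} (h : hilbQuot I n = 1) :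
    ∃ u : S3, u.IsHomogeneous n ∧ u ∉ I := by
  by_contra! hI
  have htop : Submodule.comap (homogeneousSubmodule (Fin 3) ℂ n).subtype
      (Submodule.restrictScalars ℂ I) = ⊤ := eq_top_iff.2 fun g _ => hI g.1 g.2
  rw [hilbQuot, htop] at h
  have := Module.finrank_zero_of_subsingleton (R := ℂ)
    (M := homogeneousSubmodule (Fin 3) ℂ n ⧸ (⊤ : Submodule ℂ (homogeneousSubmodule (Fin 3) ℂ n)))
  omega

/-! ### Nearly free curves -/

namespace IsPrimSyz

variable {f : S3} {e r : ℕ} {v : Fin 3 → S3}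

/-- If the Hilbert function of the quotient by the Bourbaki ideal is eventually one, then the
Bourbaki ideal is generated by two independent linear forms. -/
theorem exists_bourbakiIdeal_eq_span (H : IsPrimSyz f e r v)
    (h : ∀ᶠ n in Filter.atTop, hilbQuot (bourbakiIdeal f v) n = 1) :
    ∃ a b : Fin 3 → ℂ, a ⨯₃ b ≠ 0 ∧ bourbakiIdeal f v = Ideal.span {linForm a, linForm b} := by
  obtain ⟨N, hN⟩ := Filter.eventually_atTop.1 h
  set I := bourbakiIdeal f v with hI
  obtain ⟨u, hu, huI⟩ := exists_notMem_of_hilbQuot_eq_one (hN N le_rfl)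
  obtain ⟨j, hj⟩ : ∃ j, X j * u ∉ I := by
    by_contra! hc
    exact huI (H.mem_of_forall_X_mul_mem hc)
  have hXu : ∀ i : Fin 3, (X i * u).IsHomogeneous (N + 1) := fun i => by
    rw [add_comm]
    exact (isHomogeneous_X _ i).mul hu
  choose p hp using fun i => exists_sub_C_mul_mem (hN (N + 1) (by omega)) (hXu j) hj (hXu i)
  have hp0 : p ≠ 0 := fun h0 => hj (by simpa [h0] using hp j)
  have hpI : ∀ i, X i - C (p i) * X j ∈ I := fun i =>
    H.mem_of_forall_isHomogeneous_mul_mem N fun g hg => by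
      obtain ⟨c, hc⟩ := exists_sub_C_mul_mem (hN N le_rfl) hu huI hg
      rw [show g * (X i - C (p i) * X j) =
        (X i - C (p i) * X j) * (g - C c * u) + C c * (X i * u - C (p i) * (X j * u)) by ring]
      exact I.add_mem (I.mul_mem_left _ hc) (I.mul_mem_left _ (hp i))
  obtain ⟨a, b, rfl⟩ := exists_cross_eq_of_ne_zero hp0
  have hlin : ∀ c : Fin 3 → ℂ, c ⬝ᵥ a ⨯₃ b = 0 → linForm c ∈ I := fun c hc => by
    simpa [eval_linForm, hc] using sub_eval_mul_pow_mem hpI (isHomogeneous_linForm c)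
  have hle : Ideal.span {linForm a, linForm b} ≤ I := Ideal.span_le.2 <| by
    rintro _ (rfl | rfl)
    exacts [hlin a (dot_self_cross _ _), hlin b (dot_cross_self _ _)]
  refine ⟨a, b, hp0, le_antisymm (fun g hg => ?_) hle⟩
  obtain ⟨l, -, -, hl⟩ := exists_sub_mem_span_pair hp0
  rw [← sum_homogeneousComponent g]
  refine Ideal.sum_mem _ fun i _ => ?_
  have hgi := homogeneousComponent_isHomogeneous i g
  rw [mem_span_pair_iff_eval_eq_zero hp0 hgi]
  by_contra hne
  have hli : l ^ i ∈ I := by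
    have h1 := I.sub_mem (H.homogeneousComponent_mem hg i) (hle (sub_eval_mul_pow_mem hl hgi))
    rw [sub_sub_cancel] at h1
    exact (Ideal.unit_mul_mem_iff_mem I ((isUnit_iff_ne_zero.2 hne).map C)).1 h1
  obtain ⟨u', hu', hu'I⟩ := exists_notMem_of_hilbQuot_eq_one (hN (i + N) (by omega))
  refine hu'I ?_
  have h1 := I.add_mem (hle (sub_eval_mul_pow_mem hl hu'))
    (I.mul_mem_left (C (eval (a ⨯₃ b) u') * l ^ N) hli)
  rwa [show u' - C (eval (a ⨯₃ b) u') * l ^ (i + N) + C (eval (a ⨯₃ b) u') * l ^ N * l ^ i = u' by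
    ring] at h1

end IsPrimSyz

theorem image_setOf_ne_zero {α : Type*} (x y z : α) :
    ![x, y, z] '' {j | j ≠ 0} = {y, z} := by
  ext w
  simp [Fin.exists_fin_succ, eq_comm]

theorem image_setOf_ne_one {α : Type*} (x y z : α) :
    ![x, y, z] '' {j | j ≠ 1} = {x, z} := by
  ext w
  simp [Fin.exists_fin_succ, eq_comm]

theorem image_setOf_ne_two {α : Type*} (x y z : α) :
    ![x, y, z] '' {j | j ≠ 2} = {x, y} := by
  ext w
  simp [Fin.exists_fin_succ, eq_comm]

theorem vecComponent_smul_of_lt {w : Fin 3 → S3} {j n : ℕ} (hw : ∀ i, (w i).IsHomogeneous j)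
    (hn : n < j) (s : S3) : vecComponent n (s • w) = 0 := funext fun i => by
  simp [vecComponent, mul_comm s, homogeneousComponent_mul_of_lt (hw i) hn]

theorem vecComponent_add (n : ℕ) (u w : Fin 3 → S3) :
    vecComponent n (u + w) = vecComponent n u + vecComponent n w := funext fun i => by
  simp [vecComponent]

namespace IsPrimSyz

variable {f : S3} {e r : ℕ} {v : Fin 3 → S3}

theorem notMem_span_pair (H : IsPrimSyz f e r v) {a b : Fin 3 → ℂ} (hab : a ⨯₃ b ≠ 0) {j : ℕ}
    (hj : r ≤ j) {w₁ w₂ : Fin 3 → S3} (hw₁ : ∀ i, (w₁ i).IsHomogeneous j)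
    (hw₂ : ∀ i, (w₂ i).IsHomogeneous j) (h₁ : v ⨯₃ w₁ = linForm a • grad f)
    (h₂ : v ⨯₃ w₂ = linForm b • grad f) : v ∉ Submodule.span S3 {w₁, w₂} := by
  intro hv
  obtain ⟨s, t, hst⟩ := Submodule.mem_span_pair.1 hv
  have hcomp : vecComponent r (s • w₁) + vecComponent r (t • w₂) = v := by
    rw [← vecComponent_add, hst, vecComponent_of_isHomogeneous H.hom]
  rcases hj.lt_or_eq with hlt | rfl
  · rw [vecComponent_smul_of_lt hw₁ hlt, vecComponent_smul_of_lt hw₂ hlt, add_zero] at hcomp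
    exact H.ne_zero hcomp.symm
  · have hrel : linForm a * s + linForm b * t = 0 := by
      apply smul_injective_of_ne_zero H.grad_ne_zero
      have := congrArg (v ⨯₃ ·) hst
      simp only [map_add, map_smul, h₁, h₂, cross_self] at this
      rw [zero_smul, ← this, add_smul, smul_smul, smul_smul, mul_comm s, mul_comm t]
    have h1 := congrArg (homogeneousComponent (1 + 0)) hrel
    rw [map_add, map_zero, homogeneousComponent_add_mul (isHomogeneous_linForm a),
      homogeneousComponent_add_mul (isHomogeneous_linForm b), homogeneousComponent_zero,
      homogeneousComponent_zero, mul_comm, mul_comm (linForm b), ← linForm_smul, ← linForm_smul,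
      ← linForm_add, ← linForm_zero] at h1
    have h2 := linForm_injective h1
    have hs : coeff 0 s = 0 := by
      have := congrArg (· ⨯₃ b) h2
      simpa [cross_self, hab] using this
    have ht : coeff 0 t = 0 := by
      have := congrArg (a ⨯₃ ·) h2
      simpa [cross_self, hab] using this
    have hs' := vecComponent_smul hw₁ s 0
    have ht' := vecComponent_smul hw₂ t 0
    rw [add_zero, homogeneousComponent_zero, hs, C_0, zero_smul] at hs'
    rw [add_zero, homogeneousComponent_zero, ht, C_0, zero_smul] at ht'
    rw [hs', ht', add_zero] at hcomp
    exact H.ne_zero hcomp.symm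

theorem notMem_span_pair_self (H : IsPrimSyz f e r v) {a b : Fin 3 → ℂ} (hab : a ⨯₃ b ≠ 0)
    {w₁ w₂ : Fin 3 → S3} (h₁ : v ⨯₃ w₁ = linForm a • grad f)
    (h₂ : v ⨯₃ w₂ = linForm b • grad f) : w₁ ∉ Submodule.span S3 {v, w₂} := by
  intro hw
  obtain ⟨s, t, rfl⟩ := Submodule.mem_span_pair.1 hw
  rw [map_add, map_smul, map_smul, cross_self, smul_zero, zero_add, h₂, smul_smul] at h₁
  exact hab (cross_eq_zero_of_linForm_dvd
    (Dvd.intro_left t (smul_injective_of_ne_zero H.grad_ne_zero h₁)))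

theorem exists_isMinGenSyz (H : IsPrimSyz f e r v) (hmdr : IsMDR f r) {a b : Fin 3 → ℂ}
    (hab : a ⨯₃ b ≠ 0) (hI : bourbakiIdeal f v = Ideal.span {linForm a, linForm b}) :
    2 * r ≤ e + 1 ∧ ∃ u, IsMinGenSyz f 3 ![r, e + 1 - r, e + 1 - r] u := by
  have hre := H.le
  have hlift : ∀ c, linForm c ∈ bourbakiIdeal f v → ∃ w ∈ jacSyz f,
      (∀ i, (w i).IsHomogeneous (e + 1 - r)) ∧ v ⨯₃ w = linForm c • grad f := fun c hc => by
    have := H.exists_homogeneous hc (show r + (e + 1 - r) = e + 1 by omega)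
    rwa [homogeneousComponent_eq_self (isHomogeneous_linForm c)] at this
  obtain ⟨w₁, hm₁, hw₁, h₁⟩ := hlift a (hI ▸ Ideal.subset_span (by simp))
  obtain ⟨w₂, hm₂, hw₂, h₂⟩ := hlift b (hI ▸ Ideal.subset_span (by simp))
  have hba : b ⨯₃ a ≠ 0 := by rwa [← cross_anticomm, neg_ne_zero]
  have hmin₁ := H.notMem_span_pair_self hab h₁ h₂
  have hmin₂ := H.notMem_span_pair_self hba h₂ h₁
  have hw₁0 : w₁ ≠ 0 := fun h => hmin₁ (h ▸ zero_mem _)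
  have hw₂0 : w₂ ≠ 0 := fun h => hmin₂ (h ▸ zero_mem _)
  have hle : r ≤ e + 1 - r := by
    by_contra! hlt
    exact hw₁0 (hmdr.2 _ hlt w₁ hm₁ hw₁)
  refine ⟨by omega, ![v, w₁, w₂], ?_, ?_, ?_, le_antisymm ?_ fun w hw => ?_, ?_, ?_⟩
  · intro j
    fin_cases j
    exacts [H.mem, hm₁, hm₂]
  · intro j
    fin_cases j
    exacts [H.hom, hw₁, hw₂]
  · intro j
    fin_cases j
    exacts [H.ne_zero, hw₁0, hw₂0]
  · rw [Submodule.span_le]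
    rintro _ ⟨j, rfl⟩
    fin_cases j
    exacts [H.mem, hm₁, hm₂]
  · obtain ⟨g, hg⟩ := H.exists_cross_eq hw
    have hgI : g ∈ bourbakiIdeal f v := ⟨w, hw, hg⟩
    rw [hI, Ideal.mem_span_pair] at hgI
    obtain ⟨s, t, rfl⟩ := hgI
    obtain ⟨q, hq⟩ := H.eq_smul (w := w - (s • w₁ + t • w₂)) (by
      rw [map_sub, map_add, map_smul, map_smul, h₁, h₂, hg, smul_smul, smul_smul, add_smul,
        sub_self])
    refine Submodule.mem_span_range_iff_exists_fun S3 |>.2 ⟨![q, s, t], ?_⟩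
    rw [Fin.sum_univ_three]
    change q • v + s • w₁ + t • w₂ = w
    rw [← hq]
    abel
  · intro j
    fin_cases j
    · change v ∉ Submodule.span S3 (![v, w₁, w₂] '' {j' | j' ≠ 0})
      rw [image_setOf_ne_zero]
      exact H.notMem_span_pair hab hle hw₁ hw₂ h₁ h₂
    · change w₁ ∉ Submodule.span S3 (![v, w₁, w₂] '' {j' | j' ≠ 1})
      rw [image_setOf_ne_one]
      exact hmin₁
    · change w₂ ∉ Submodule.span S3 (![v, w₁, w₂] '' {j' | j' ≠ 2})
      rw [image_setOf_ne_two]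
      exact hmin₂
  · intro i j hij
    fin_cases i <;> fin_cases j <;> simp_all

/-- The Bourbaki ideal of a nearly free curve is generated by two independent linear forms. -/
theorem exists_bourbakiIdeal_eq_span_of_isMinGenSyz {u : Fin 3 → Fin 3 → S3} {d₂ : ℕ}
    (H : IsPrimSyz f e r (u 0)) (hd : r + d₂ = e + 1) (hu : IsMinGenSyz f 3 ![r, d₂, d₂] u) :
    ∃ a b : Fin 3 → ℂ, a ⨯₃ b ≠ 0 ∧
      bourbakiIdeal f (u 0) = Ideal.span {linForm a, linForm b} := by
  have hu' : u = ![u 0, u 1, u 2] := by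
    funext i
    fin_cases i <;> rfl
  obtain ⟨l₁, h₁⟩ := H.exists_cross_eq (hu.mem 1)
  obtain ⟨l₂, h₂⟩ := H.exists_cross_eq (hu.mem 2)
  obtain ⟨a, ha⟩ := exists_eq_sum_C_mul_X (H.isHomogeneous_of_cross_eq (hu.hom 1) h₁ hd)
  obtain ⟨b, hb⟩ := exists_eq_sum_C_mul_X (H.isHomogeneous_of_cross_eq (hu.hom 2) h₂ hd)
  change l₁ = linForm a at ha
  change l₂ = linForm b at hb
  subst ha hb
  refine ⟨a, b, fun hab => ?_, le_antisymm ?_ (Ideal.span_le.2 ?_)⟩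
  · have hmin₁ := hu.minimal 1
    have hmin₂ := hu.minimal 2
    rw [hu', image_setOf_ne_one] at hmin₁
    rw [hu', image_setOf_ne_two] at hmin₂
    by_cases hb0 : b = 0
    · rw [hb0, linForm_zero, zero_smul] at h₂
      obtain ⟨s, hs⟩ := H.eq_smul h₂
      exact hmin₂ (Submodule.mem_span_pair.2 ⟨s, 0, by simp [hs]⟩)
    · obtain ⟨c, hc⟩ := exists_eq_smul_of_cross_eq_zero (a := b) (u := a)
        (fun p hp => absurd (isUnit_iff_ne_zero.2 hp.ne_zero) hp.not_isUnit) hb0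
        (by rw [← cross_anticomm, hab, neg_zero])
      obtain ⟨s, hs⟩ := H.eq_smul (w := u 1 - (C c : S3) • u 2) (by
        rw [map_sub, map_smul, h₁, h₂, hc, linForm_smul, mul_smul, sub_self])
      exact hmin₁ (Submodule.mem_span_pair.2 ⟨s, C c, by simp [← hs]⟩)
  · rintro g ⟨w, hw, hg⟩
    rw [← hu.span_eq, Submodule.mem_span_range_iff_exists_fun] at hw
    obtain ⟨c, rfl⟩ := hw
    rw [Fin.sum_univ_three, map_add, map_add, map_smul, map_smul, map_smul, cross_self, h₁, h₂,
      smul_zero, zero_add, smul_smul, smul_smul, ← add_smul] at hg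
    exact Ideal.mem_span_pair.2 ⟨_, _, smul_injective_of_ne_zero H.grad_ne_zero hg⟩
  · rintro _ (rfl | rfl)
    exacts [⟨_, hu.mem 1, h₁⟩, ⟨_, hu.mem 2, h₂⟩]

end IsPrimSyz

theorem IsMinGenSyz.eq_of_isMDR {f : S3} {r m : ℕ} {dd : Fin (m + 1) → ℕ}
    {u : Fin (m + 1) → Fin 3 → S3} (hu : IsMinGenSyz f (m + 1) dd u) (hmdr : IsMDR f r) :
    dd 0 = r := by
  refine le_antisymm ?_ ?_
  · by_contra! hlt
    obtain ⟨⟨w, hw, hw0, hwr⟩, -⟩ := hmdr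
    rw [← hu.span_eq, Submodule.mem_span_range_iff_exists_fun] at hw
    obtain ⟨c, rfl⟩ := hw
    refine hw0 (funext fun i => ?_)
    rw [← homogeneousComponent_eq_self (hwr i), Finset.sum_apply, map_sum]
    refine Finset.sum_eq_zero fun j _ => ?_
    rw [Pi.smul_apply, smul_eq_mul, mul_comm]
    exact homogeneousComponent_mul_of_lt (hu.hom j i) (hlt.trans_le (hu.mono (Fin.zero_le j))) _
  · by_contra! hlt
    exact hu.ne_zero 0 (hmdr.2 _ hlt _ (hu.mem 0) (hu.hom 0))

theorem isPrimSyz_of_isMDR {f : S3} {e r : ℕ} (hhom : f.IsHomogeneous (e + 1))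
    (hred : Squarefree f) (hmdr : IsMDR f r) {v : Fin 3 → S3} (hv : v ∈ jacSyz f)
    (hr : ∀ i, (v i).IsHomogeneous r) (hv0 : v ≠ 0) : IsPrimSyz f e r v := by
  have hF : ∀ i, (grad f i).IsHomogeneous e := fun i => hhom.pderiv
  have hF0 := grad_ne_zero (Nat.succ_ne_zero e) hhom hred.ne_zero
  exact ⟨hF, hF0, fun p hp => exists_not_dvd_grad (Nat.succ_ne_zero e) hhom hred hp, hv, hr, hv0,
    fun p hp => exists_not_dvd_of_isMDR hF hmdr hv hr hv0 hp, mdr_le hF hF0 hmdr⟩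

/-- A reduced plane curve `C : f = 0` of degree `d ≥ 3` (not the union of `d` lines through
one point) with `r = mdr(f)` satisfies `τ(C) = (d-1)² - r(d-r-1) - 1` if and only if `C` is
nearly free; moreover in that case `2r ≤ d`. -/
theorem statement2 (f : S3) (d r τ : ℕ) (hd : 3 ≤ d)
    (hhom : f.IsHomogeneous d) (hred : Squarefree f)
    (hlines : ¬ IsUnionOfConcurrentLines f d)
    (hmdr : IsMDR f r) (htau : IsTjurina f τ) :
    ((τ : ℤ) = ((d : ℤ) - 1) ^ 2 - r * ((d : ℤ) - r - 1) - 1 ↔ IsNearlyFree f d) ∧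
    ((τ : ℤ) = ((d : ℤ) - 1) ^ 2 - r * ((d : ℤ) - r - 1) - 1 → 2 * r ≤ d) := by
  obtain ⟨e, rfl⟩ : ∃ e, d = e + 1 := ⟨d - 1, by omega⟩
  have hsub : (((e + 1 : ℕ) : ℤ) - 1) ^ 2 - r * (((e + 1 : ℕ) : ℤ) - r - 1) - 1 =
      (e : ℤ) ^ 2 - r * (e - r) - 1 := by
    push_cast
    ring
  rw [hsub]
  have forward : (τ : ℤ) = (e : ℤ) ^ 2 - r * (e - r) - 1 →
      IsNearlyFree f (e + 1) ∧ 2 * r ≤ e + 1 := by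
    intro hτ
    obtain ⟨v, hv, hv0, hvr⟩ := hmdr.1
    have H := isPrimSyz_of_isMDR hhom hred hmdr hv hvr hv0
    obtain ⟨a, b, hab, hI⟩ := H.exists_bourbakiIdeal_eq_span
      ((H.eventually_hilbQuot htau).mono fun n hn => by
        zify
        linarith)
    obtain ⟨h2r, hu⟩ := H.exists_isMinGenSyz hmdr hab hI
    exact ⟨⟨r, e + 1 - r, by omega, hu⟩, h2r⟩
  refine ⟨⟨fun hτ => (forward hτ).1, ?_⟩, fun hτ => (forward hτ).2⟩
  rintro ⟨d₁, d₂, hd₁₂, u, hu⟩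
  obtain rfl : d₁ = r := hu.eq_of_isMDR hmdr
  have H := isPrimSyz_of_isMDR hhom hred hmdr (hu.mem 0) (hu.hom 0) (hu.ne_zero 0)
  obtain ⟨a, b, hab, hI⟩ := H.exists_bourbakiIdeal_eq_span_of_isMinGenSyz hd₁₂ hu
  obtain ⟨n, hn⟩ := (H.eventually_hilbQuot htau).exists
  rw [hI, hilbQuot_span_pair hab] at hn
  push_cast at hn
  linarith

end
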